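/- Let G = ⟨a,b_1,…,b_r⟩ be a multi-GGS-group with r ≥ 2. Then G has the congruence subgroup property: every finite-index subgroup of G contains st_G(n) for some n. -/

import Mathlib

/-!
Automorphisms of the `p`-regular rooted tree, encoded by portraits:
an automorphism is a family of permutations of `Fin p`, one for each vertex
(vertices are finite words over `Fin p`, the root being `[]`).
-/

namespace TreeAut

variable {p : ℕ}

/-- Automorphisms of the `p`-regular rooted tree, given by their portraits. -/
def AutT (p : ℕ) : Type := List (Fin p) → Equiv.Perm (Fin p)

namespace AutT

/-- The action of a tree automorphism on the vertices (finite words over `Fin p`). -/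
def act : AutT p → List (Fin p) → List (Fin p)
  | _, [] => []
  | f, x :: w => f [] x :: act (fun v => f (x :: v)) w

/-- The section of `f` at the level-one vertex `x`; the map
`f ↦ (sections f 0, …, sections f (p-1))` restricted to the first-level
stabilizer is the isomorphism `ψ`. -/
def sections (f : AutT p) : Fin p → AutT p := fun x v => f (x :: v)

instance : One (AutT p) := ⟨fun _ => 1⟩

instance : Mul (AutT p) := ⟨fun f g v => f (act g v) * g v⟩

/-- The action of the inverse automorphism on vertices. -/
def invAct : AutT p → List (Fin p) → List (Fin p)
  | _, [] => []
  | f, x :: w => (f [])⁻¹ x :: invAct (fun v => f (((f [])⁻¹ x) :: v)) w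

instance : Inv (AutT p) := ⟨fun f v => (f (invAct f v))⁻¹⟩

lemma one_apply (v : List (Fin p)) : (1 : AutT p) v = 1 := rfl

lemma mul_apply (f g : AutT p) (v : List (Fin p)) : (f * g) v = f (act g v) * g v := rfl

lemma inv_apply (f : AutT p) (v : List (Fin p)) : f⁻¹ v = (f (invAct f v))⁻¹ := rfl

lemma act_nil (f : AutT p) : act f [] = [] := rfl

lemma act_cons (f : AutT p) (x : Fin p) (w : List (Fin p)) :
    act f (x :: w) = f [] x :: act (sections f x) w := rfl

lemma sections_mul (f g : AutT p) (x : Fin p) :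
    sections (f * g) x = sections f (g [] x) * sections g x :=
  funext fun _ => rfl

lemma act_one : ∀ v : List (Fin p), act (1 : AutT p) v = v
  | [] => rfl
  | x :: w => congrArg (x :: ·) (act_one w)

lemma act_mul (f g : AutT p) : ∀ v : List (Fin p), act (f * g) v = act f (act g v)
  | [] => rfl
  | x :: w => by
      rw [act_cons (f * g), sections_mul, act_mul, act_cons g, act_cons f]
      rfl

lemma invAct_act (f : AutT p) : ∀ v : List (Fin p), invAct f (act f v) = v
  | [] => rfl
  | x :: w => by
      rw [act_cons]
      show (f [])⁻¹ (f [] x) ::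
          invAct (fun v => f (((f [])⁻¹ (f [] x)) :: v)) (act (sections f x) w) = x :: w
      refine (congrArg (fun y => y :: invAct (sections f y) (act (sections f x) w))
        ((f []).symm_apply_apply x)).trans ?_
      exact congrArg (x :: ·) (invAct_act (sections f x) w)

instance : Group (AutT p) where
  mul_assoc f g h := by
    funext v
    show (f * g) (act h v) * h v = f (act (g * h) v) * (g * h) v
    rw [mul_apply, mul_apply, act_mul, mul_assoc]
  one_mul f := by
    funext v
    show (1 : AutT p) (act f v) * f v = f v
    rw [one_apply, one_mul]
  mul_one f := by
    funext v
    show f (act (1 : AutT p) v) * (1 : AutT p) v = f v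
    rw [act_one, one_apply, mul_one]
  inv_mul_cancel f := by
    funext v
    show f⁻¹ (act f v) * f v = (1 : AutT p) v
    rw [inv_apply, invAct_act, one_apply, inv_mul_cancel]

lemma act_length (f : AutT p) : ∀ v : List (Fin p), (act f v).length = v.length
  | [] => rfl
  | _ :: w => congrArg Nat.succ (act_length _ w)

lemma act_act_inv (f : AutT p) (v : List (Fin p)) : act f (act f⁻¹ v) = v := by
  rw [← act_mul, mul_inv_cancel, act_one]

/-- The pointwise stabilizer `st(n)` of the `n`-th level of the tree. -/
def levelStab (p n : ℕ) : Subgroup (AutT p) where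
  carrier := {f | ∀ v : List (Fin p), v.length = n → act f v = v}
  one_mem' := fun v _ => act_one v
  mul_mem' := by
    intro f g hf hg v hv
    rw [act_mul, hg v hv, hf v hv]
  inv_mem' := by
    intro f hf v hv
    have h1 : act f (act f⁻¹ v) = v := act_act_inv f v
    have h2 : act f (act f⁻¹ v) = act f⁻¹ v := hf _ (by rw [act_length, hv])
    exact h2.symm.trans h1

instance levelStab_normal (p n : ℕ) : (levelStab p n).Normal := by
  constructor
  intro f hf g v hv
  show act (g * f * g⁻¹) v = v
  rw [act_mul, act_mul, hf _ (by rw [act_length, hv]), act_act_inv]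

/-- The tuple of sections at the level-two vertices.  Restricted to the
second-level stabilizer this is the map `ψ₂`. -/
def sections2 (f : AutT p) : Fin p → Fin p → AutT p := fun x y v => f (x :: y :: v)

/-- The rooted automorphism defined by a permutation `σ` of `Fin p`. -/
def rooted (σ : Equiv.Perm (Fin p)) : AutT p := fun v => if v = [] then σ else 1

/-- The rooted automorphism `a`, acting at the root by the cycle `(1 2 … p)`. -/
def rootedA (p : ℕ) : AutT p := rooted (finRotate p)

/-- Auxiliary portrait for the directed automorphism `b_e`. -/
def directedAux (e : Fin (p - 1) → ZMod p) : List (Fin p) → Equiv.Perm (Fin p)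
  | [] => 1
  | x :: w =>
      if h : (x : ℕ) < p - 1 then
        (if w = [] then finRotate p ^ ((e ⟨x, h⟩).val) else 1)
      else directedAux e w

/-- The directed automorphism `b_e` defined by the vector `e ∈ 𝔽_p^{p-1}`,
i.e. the unique automorphism with `ψ(b_e) = (a^{e_1}, …, a^{e_{p-1}}, b_e)`. -/
def directed (e : Fin (p - 1) → ZMod p) : AutT p := directedAux e

/-- The multi-GGS-group determined by the vectors `e 1, …, e r`. -/
def multiGGS (p : ℕ) {r : ℕ} (e : Fin r → Fin (p - 1) → ZMod p) : Subgroup (AutT p) :=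
  Subgroup.closure ({rootedA p} ∪ Set.range fun i => directed (e i))

/-- The GGS-group `𝒢` defined by the (nonzero) constant vector `(c, …, c)`. -/
def constGGS (p : ℕ) (c : ZMod p) : Subgroup (AutT p) :=
  Subgroup.closure {rootedA p, directed (fun _ => c)}

/-- `G` is the GGS-group `𝒢` defined by a constant vector. -/
def IsConstGGS {p : ℕ} (G : Subgroup (AutT p)) : Prop :=
  ∃ c : ZMod p, c ≠ 0 ∧ G = constGGS p c

/-- The stabilizer `st_G(n) = G ∩ st(n)`, viewed as a subgroup of `G`. -/
def stabIn {p : ℕ} (G : Subgroup (AutT p)) (n : ℕ) : Subgroup G :=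
  (levelStab p n).comap G.subtype

instance {p : ℕ} (G : Subgroup (AutT p)) (n : ℕ) : (stabIn G n).Normal :=
  Subgroup.Normal.comap (levelStab_normal p n) G.subtype

/-- The congruence subgroup property: every finite-index subgroup of `G`
contains a level stabilizer `st_G(n)`. -/
def HasCSP {p : ℕ} (G : Subgroup (AutT p)) : Prop :=
  ∀ H : Subgroup G, H.FiniteIndex → ∃ n : ℕ, stabIn G n ≤ H

/-- `G` is just infinite: it is infinite and all its nontrivial normal
subgroups have finite index. -/
def JustInfinite {p : ℕ} (G : Subgroup (AutT p)) : Prop :=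
  Infinite G ∧ ∀ N : Subgroup G, N.Normal → N ≠ ⊥ → N.FiniteIndex

end AutT

end TreeAut

open TreeAut AutT Subgroup

namespace TreeAut.AutT

open scoped commutatorElement

section Tree

variable {p : ℕ}

lemma ext_sections {f g : AutT p} (hroot : f [] = g [])
    (hsec : ∀ x, sections f x = sections g x) : f = g := by
  funext v
  cases v with
  | nil => exact hroot
  | cons x w => exact congrFun (hsec x) w

lemma one_root : (1 : AutT p) [] = 1 := rfl

lemma mul_root (f g : AutT p) : (f * g) [] = f [] * g [] := rfl

lemma inv_root (f : AutT p) : f⁻¹ [] = (f [])⁻¹ := rfl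

lemma sections_one (x : Fin p) : sections (1 : AutT p) x = 1 := rfl

lemma sections_inv (f : AutT p) (x : Fin p) :
    sections f⁻¹ x = (sections f ((f [])⁻¹ x))⁻¹ := by
  rw [eq_inv_iff_mul_eq_one]
  have h := sections_mul f⁻¹ f ((f [])⁻¹ x)
  rw [inv_mul_cancel, sections_one] at h
  exact (congrArg (fun y => sections f⁻¹ y * _) ((f []).apply_symm_apply x)).symm.trans h.symm

lemma mem_levelStab_succ {n : ℕ} {f : AutT p} :
    f ∈ levelStab p (n + 1) ↔ f [] = 1 ∧ ∀ x, sections f x ∈ levelStab p n := by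
  constructor
  · intro h
    by_cases hp : p = 0
    · subst hp
      exact ⟨Subsingleton.elim _ _, fun x => x.elim0⟩
    have key : ∀ x (w : List (Fin p)), w.length = n →
        f [] x = x ∧ act (sections f x) w = w := fun x w hw => by
      have := h (x :: w) (by simp [hw])
      rw [act_cons] at this
      exact ⟨(List.cons.inj this).1, (List.cons.inj this).2⟩
    exact ⟨Equiv.ext fun x => (key x (List.replicate n x) (by simp)).1,
      fun x w hw => (key x w hw).2⟩
  · rintro ⟨h0, h1⟩ v hv
    cases v with
    | nil => rfl
    | cons x w =>
      rw [act_cons, h0, h1 x w (by simpa using hv)]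
      rfl

lemma mem_levelStab_one {f : AutT p} : f ∈ levelStab p 1 ↔ f [] = 1 := by
  rw [mem_levelStab_succ]
  refine ⟨And.left, fun h => ⟨h, fun x v hv => ?_⟩⟩
  rw [List.length_eq_zero_iff.mp hv, act_nil]

lemma levelStab_add_le (n m : ℕ) : levelStab p (n + m) ≤ levelStab p n := by
  induction n with
  | zero =>
    intro f _ v hv
    rw [List.length_eq_zero_iff.mp hv, act_nil]
  | succ n ih =>
    intro f hf
    rw [Nat.add_right_comm, mem_levelStab_succ] at hf
    exact mem_levelStab_succ.mpr ⟨hf.1, fun x => ih (hf.2 x)⟩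

lemma root_eq_one_of_mem_levelStab_succ {n : ℕ} {f : AutT p}
    (hf : f ∈ levelStab p (n + 1)) : f [] = 1 := (mem_levelStab_succ.mp hf).1

lemma exists_act_ne {f : AutT p} (hf : f ≠ 1) : ∃ u, act f u ≠ u := by
  by_contra! h
  apply hf
  funext v
  induction v generalizing f with
  | nil =>
    refine Equiv.ext fun x => ?_
    have := h [x]
    rw [act_cons] at this
    exact (List.cons.inj this).1
  | cons x w ih =>
    have hw : ∀ u, act (sections f x) u = u := fun u => by
      have := h (x :: u)
      rw [act_cons] at this
      exact (List.cons.inj this).2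
    by_cases h1 : sections f x = 1
    · exact congrFun h1 w
    · exact ih h1 hw

/-- The automorphism fixing the first level with prescribed sections: the inverse of `ψ`. -/
def ofSections : (Fin p → AutT p) →* AutT p where
  toFun f
    | [] => 1
    | x :: w => f x w
  map_one' := ext_sections rfl fun _ => rfl
  map_mul' _ _ := ext_sections rfl fun _ => rfl

lemma ofSections_sections {f : AutT p} (hf : f [] = 1) : ofSections (sections f) = f :=
  ext_sections hf.symm fun _ => rfl

/-- The automorphism acting as `f` on the subtree at the level-one vertex `x` and trivially
elsewhere. -/
def inj (x : Fin p) : AutT p →* AutT p :=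
  ofSections.comp (MonoidHom.mulSingle (fun _ => AutT p) x)

lemma inj_root (x : Fin p) (f : AutT p) : inj x f [] = 1 := rfl

lemma sections_inj (x y : Fin p) (f : AutT p) :
    sections (inj x f) y = if y = x then f else 1 := by
  change Pi.mulSingle (M := fun _ => AutT p) x f y = _
  by_cases h : y = x
  · subst h; simp
  · simp [h]

lemma conj_inj (h f : AutT p) (x : Fin p) :
    h * inj x f * h⁻¹ = inj (h [] x) (sections h x * f * (sections h x)⁻¹) := by
  rw [mul_inv_eq_iff_eq_mul]
  refine ext_sections (by rw [mul_root, mul_root, inj_root, inj_root, mul_one, one_mul]) fun y => ?_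
  simp only [sections_mul, inj_root, sections_inj, Equiv.Perm.one_apply,
    EmbeddingLike.apply_eq_iff_eq]
  split_ifs with hy
  · subst hy; group
  · simp

lemma commutator_inj (h f : AutT p) (x : Fin p) (hh : h [] = 1) :
    ⁅inj x f, h⁆ = inj x ⁅f, sections h x⁆ := by
  have := conj_inj h f⁻¹ x
  rw [hh, Equiv.Perm.one_apply, map_inv] at this
  rw [commutatorElement_def, commutatorElement_def, mul_assoc, mul_assoc, ← mul_assoc h,
    this, ← map_mul]
  group

lemma inj_commute {x y : Fin p} (hxy : x ≠ y) (f g : AutT p) :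
    Commute (inj x f) (inj y g) := by
  refine ext_sections rfl fun z => ?_
  simp only [sections_mul, inj_root, sections_inj, Equiv.Perm.one_apply]
  split_ifs with h1 h2
  · exact absurd (h1.symm.trans h2) hxy
  all_goals simp

lemma mem_of_inj_sections_mem {K : Subgroup (AutT p)} {f : AutT p} (hf : f [] = 1)
    (h : ∀ x, inj x (sections f x) ∈ K) : f ∈ K := by
  rw [← ofSections_sections hf]
  exact pi_mem_of_mulSingle_mem (H := K.comap ofSections) (sections f) h

/-- The automorphism acting as `f` on the subtree at the vertex `u` and trivially elsewhere. -/
def injWord : List (Fin p) → AutT p →* AutT p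
  | [] => MonoidHom.id _
  | x :: u => (inj x).comp (injWord u)

/-- The section of an automorphism at an arbitrary vertex. -/
def secWord (f : AutT p) : List (Fin p) → AutT p
  | [] => f
  | x :: u => secWord (sections f x) u

lemma conj_injWord (h f : AutT p) (u : List (Fin p)) :
    h * injWord u f * h⁻¹ = injWord (act h u) (secWord h u * f * (secWord h u)⁻¹) := by
  induction u generalizing h with
  | nil => rfl
  | cons x u ih =>
    change h * inj x (injWord u f) * h⁻¹ = inj (h [] x) (injWord (act (sections h x) u) _)
    rw [conj_inj, ih]
    rfl

lemma injWord_commute {u v : List (Fin p)} (hl : u.length = v.length) (huv : u ≠ v)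
    (f g : AutT p) : Commute (injWord u f) (injWord v g) := by
  induction u generalizing v with
  | nil =>
    cases v with
    | nil => exact absurd rfl huv
    | cons => simp at hl
  | cons x u ih =>
    cases v with
    | nil => simp at hl
    | cons y v =>
      by_cases hxy : x = y
      · subst hxy
        exact (ih (by simpa using hl) fun h => huv (h ▸ rfl)).map (inj x)
      · exact inj_commute hxy _ _

lemma mem_of_injWord_secWord_mem {K : Subgroup (AutT p)} {n : ℕ} {f : AutT p}
    (hf : f ∈ levelStab p n) (h : ∀ u, u.length = n → injWord u (secWord f u) ∈ K) : f ∈ K := by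
  induction n generalizing f K with
  | zero => exact h [] rfl
  | succ n ih =>
    rw [mem_levelStab_succ] at hf
    refine mem_of_inj_sections_mem hf.1 fun x => ?_
    exact ih (K := K.comap (inj x)) (hf.2 x) fun u hu => h (x :: u) (by simp [hu])

lemma secWord_mem_levelStab {f : AutT p} {u : List (Fin p)} {n m : ℕ} (hu : u.length = n)
    (hf : f ∈ levelStab p (n + m)) : secWord f u ∈ levelStab p m := by
  subst hu
  induction u generalizing f with
  | nil => exact (Nat.zero_add m) ▸ hf
  | cons x u ih =>
    refine ih ?_
    rw [List.length_cons, Nat.add_right_comm, mem_levelStab_succ] at hf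
    exact hf.2 x

end Tree

section NormalizedBy

variable {Γ : Type*} [Group Γ]

lemma conj_mem_commutator {G K L : Subgroup Γ} (hK : ∀ h ∈ G, ∀ f ∈ K, h * f * h⁻¹ ∈ K)
    (hL : ∀ h ∈ G, ∀ f ∈ L, h * f * h⁻¹ ∈ L) :
    ∀ h ∈ G, ∀ f ∈ ⁅K, L⁆, h * f * h⁻¹ ∈ ⁅K, L⁆ := by
  intro h hh
  suffices ⁅K, L⁆ ≤ ⁅K, L⁆.comap (MulAut.conj h).toMonoidHom from fun f hf => this hf
  rw [commutator_le]
  intro k hk l hl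
  rw [mem_comap, map_commutatorElement]
  exact commutator_mem_commutator (hK h hh k hk) (hL h hh l hl)

lemma commutator_mul_right_eq (x y z : Γ) : ⁅x, y * z⁆ = ⁅x, y⁆ * (y * ⁅x, z⁆ * y⁻¹) := by
  simp only [commutatorElement_def]; group

lemma commutator_mul_left_eq (x y z : Γ) : ⁅x * y, z⁆ = x * ⁅y, z⁆ * x⁻¹ * ⁅x, z⁆ := by
  simp only [commutatorElement_def]; group

lemma commutator_closure_le {S : Set Γ} {N : Subgroup Γ}
    (hN : ∀ h ∈ closure S, ∀ f ∈ N, h * f * h⁻¹ ∈ N) (hS : ∀ s ∈ S, ∀ t ∈ S, ⁅s, t⁆ ∈ N) :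
    ⁅closure S, closure S⁆ ≤ N := by
  rw [commutator_le]
  have right : ∀ x ∈ closure S, (∀ t ∈ S, ⁅x, t⁆ ∈ N) → ∀ y ∈ closure S, ⁅x, y⁆ ∈ N := by
    intro x _ hx y hy
    induction hy using closure_induction with
    | mem t ht => exact hx t ht
    | one => simp
    | mul y z hy _ ihy ihz =>
      rw [commutator_mul_right_eq]
      exact mul_mem ihy (hN y hy _ ihz)
    | inv y hy ih =>
      have h1 : ⁅x, y⁻¹⁆ = y⁻¹ * ⁅x, y⁆⁻¹ * y⁻¹⁻¹ := by
        simp only [commutatorElement_def]; group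
      rw [h1]
      exact hN _ (inv_mem hy) _ (inv_mem ih)
  intro x hx y hy
  have hx' := hx
  induction hx using closure_induction with
  | mem s hs => exact right s hx' (hS s hs) y hy
  | one => simp
  | mul x z hx hz ihx ihz =>
    rw [commutator_mul_left_eq]
    exact mul_mem (hN x hx _ (ihz hz)) (ihx hx)
  | inv x hx ih =>
    have h1 : ⁅x⁻¹, y⁆ = x⁻¹ * ⁅x, y⁆⁻¹ * x⁻¹⁻¹ := by
      simp only [commutatorElement_def]; group
    rw [h1]
    exact hN _ (inv_mem hx) _ (inv_mem (ih hx))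

end NormalizedBy

section Generators

variable {p : ℕ}

/-- The label of a level-one vertex: labels are `1, …, p`, read modulo `p`. -/
def label (x : Fin p) : ZMod p := (x : ℕ) + 1

lemma label_injective : Function.Injective (label (p := p)) := by
  intro x y h
  have h1 : ((x : ℕ) : ZMod p) = (y : ℕ) := add_right_cancel h
  rw [ZMod.natCast_eq_natCast_iff', Nat.mod_eq_of_lt x.2, Nat.mod_eq_of_lt y.2] at h1
  exact Fin.ext h1

lemma label_surjective [NeZero p] : Function.Surjective (label (p := p)) := fun c =>
  ⟨⟨(c - 1).val, ZMod.val_lt _⟩, by simp [label]⟩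

lemma val_label_sub_one (x : Fin p) : (label x - 1).val = x := by
  rw [label, add_sub_cancel_right, ZMod.val_natCast_of_lt x.2]

lemma label_eq_zero_iff (x : Fin p) : label x = 0 ↔ ¬ (x : ℕ) < p - 1 := by
  have : label x = ((x + 1 : ℕ) : ZMod p) := by simp [label]
  rw [this, ZMod.natCast_eq_zero_iff]
  have hx := x.2
  constructor
  · intro h h'
    have := Nat.le_of_dvd (by lia) h
    lia
  · intro h
    have : (x : ℕ) + 1 = p := by lia
    rw [this]

lemma label_finRotate (x : Fin p) : label (finRotate p x) = label x + 1 := by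
  have := x.neZero
  rw [finRotate_apply, label, label, Fin.val_add]
  simp

lemma rootedA_root : rootedA p [] = finRotate p := rfl

lemma sections_rootedA (x : Fin p) : sections (rootedA p) x = 1 := rfl

lemma sections_rootedA_pow (k : ℕ) (x : Fin p) : sections (rootedA p ^ k) x = 1 := by
  induction k with
  | zero => rfl
  | succ k ih => rw [pow_succ', sections_mul, ih, sections_rootedA, one_mul]

lemma label_rootedA_pow (k : ℕ) (x : Fin p) : label ((rootedA p ^ k) [] x) = label x + k := by
  induction k with
  | zero => simp [one_root]
  | succ k ih =>
    rw [pow_succ', mul_root, Equiv.Perm.mul_apply, rootedA_root, label_finRotate, ih]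
    push_cast
    ring

lemma rootedA_pow_self : rootedA p ^ p = 1 := by
  refine ext_sections (Equiv.ext fun x => label_injective ?_) fun x => sections_rootedA_pow p x
  rw [label_rootedA_pow]
  simp [one_root]

lemma rootedA_pow_congr {m n : ℕ} (h : (m : ZMod p) = n) : rootedA p ^ m = rootedA p ^ n := by
  rw [pow_eq_pow_mod m rootedA_pow_self, pow_eq_pow_mod n rootedA_pow_self,
    (ZMod.natCast_eq_natCast_iff' m n p).mp h]

/-- The power of `a` with exponent in `ZMod p`. -/
def aPow (c : ZMod p) : AutT p := rootedA p ^ c.val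

lemma rootedA_pow_eq_aPow [NeZero p] (k : ℕ) : rootedA p ^ k = aPow (k : ZMod p) :=
  rootedA_pow_congr (by simp)

lemma aPow_zero : aPow (0 : ZMod p) = 1 := by simp [aPow]

lemma aPow_one [Fact p.Prime] : aPow (1 : ZMod p) = rootedA p := by
  simp [aPow, ZMod.val_one]

lemma aPow_add [NeZero p] (c d : ZMod p) : aPow (c + d) = aPow c * aPow d := by
  rw [aPow, aPow, aPow, ← pow_add]
  exact rootedA_pow_congr (by simp)

lemma aPow_neg [NeZero p] (c : ZMod p) : aPow (-c) = (aPow c)⁻¹ := by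
  rw [eq_inv_iff_mul_eq_one, ← aPow_add, neg_add_cancel, aPow_zero]

lemma aPow_commute (c d : ZMod p) : Commute (aPow c) (aPow d) :=
  (Commute.refl (rootedA p)).pow_pow _ _

lemma sections_aPow (c : ZMod p) (x : Fin p) : sections (aPow c) x = 1 :=
  sections_rootedA_pow _ _

lemma label_aPow [NeZero p] (c : ZMod p) (x : Fin p) : label (aPow c [] x) = label x + c := by
  rw [aPow, label_rootedA_pow]
  simp

/-- The defining vector `v` seen as a function on `ZMod p` vanishing at `0`. -/
def hat : (Fin (p - 1) → ZMod p) →ₗ[ZMod p] (ZMod p → ZMod p) where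
  toFun v d := if h : (d - 1).val < p - 1 then v ⟨(d - 1).val, h⟩ else 0
  map_add' v w := by
    funext d
    simp only [Pi.add_apply]
    split_ifs <;> simp
  map_smul' c v := by
    funext d
    simp only [Pi.smul_apply, RingHom.id_apply]
    split_ifs <;> simp

lemma hat_label (v : Fin (p - 1) → ZMod p) (x : Fin p) (h : (x : ℕ) < p - 1) :
    hat v (label x) = v ⟨x, h⟩ := by
  change (if h : (label x - 1).val < p - 1 then v ⟨(label x - 1).val, h⟩ else 0) = _
  simp [val_label_sub_one, h]

lemma hat_zero_right [NeZero p] (v : Fin (p - 1) → ZMod p) : hat v 0 = 0 := by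
  obtain ⟨x, hx⟩ := label_surjective (0 : ZMod p)
  rw [← hx]
  refine (dif_neg ?_).trans hx.symm
  rw [val_label_sub_one]
  exact (label_eq_zero_iff x).mp hx

lemma hat_injective : Function.Injective (hat (p := p)) := by
  intro v w h
  funext i
  have hi : (i : ℕ) < p := by lia
  have h1 := congrFun h (label ⟨i, hi⟩)
  rwa [hat_label v ⟨i, hi⟩ i.2, hat_label w ⟨i, hi⟩ i.2] at h1

lemma directed_root (v : Fin (p - 1) → ZMod p) : directed v [] = 1 := rfl

lemma rooted_pow (k : ℕ) : rooted (finRotate p ^ k) = rootedA p ^ k := by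
  refine ext_sections ?_ fun x => (sections_rootedA_pow k x).symm
  induction k with
  | zero => rfl
  | succ k ih =>
    rw [pow_succ', pow_succ', mul_root, ← ih]
    rfl

lemma sections_directed (v : Fin (p - 1) → ZMod p) (x : Fin p) :
    sections (directed v) x = if label x = 0 then directed v else aPow (hat v (label x)) := by
  split_ifs with h
  · rw [label_eq_zero_iff] at h
    funext w
    change directedAux v (x :: w) = directedAux v w
    rw [directedAux, dif_neg h]
  · rw [label_eq_zero_iff, not_not] at h
    rw [hat_label v x h, aPow, ← rooted_pow]
    funext w
    change directedAux v (x :: w) = _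
    rw [directedAux, dif_pos h]
    rfl

lemma directed_add [NeZero p] (v w : Fin (p - 1) → ZMod p) :
    directed (v + w) = directed v * directed w := by
  funext u
  induction u with
  | nil => rfl
  | cons x u ih =>
    change sections (directed (v + w)) x u = sections (directed v * directed w) x u
    rw [sections_mul, directed_root, Equiv.Perm.one_apply, sections_directed,
      sections_directed, sections_directed]
    split_ifs
    · exact ih
    · rw [map_add, Pi.add_apply, aPow_add]

lemma directed_zero [NeZero p] : directed (0 : Fin (p - 1) → ZMod p) = 1 := by
  have h := directed_add (0 : Fin (p - 1) → ZMod p) 0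
  rwa [add_zero, left_eq_mul] at h

lemma directed_neg [NeZero p] (v : Fin (p - 1) → ZMod p) : directed (-v) = (directed v)⁻¹ := by
  rw [eq_inv_iff_mul_eq_one, ← directed_add, neg_add_cancel, directed_zero]

lemma directed_commute [NeZero p] (v w : Fin (p - 1) → ZMod p) :
    Commute (directed v) (directed w) := by
  rw [Commute, SemiconjBy, ← directed_add, ← directed_add, add_comm]

/-- The multi-GGS-group attached to a space of defining vectors. -/
def spaceGGS (V : Submodule (ZMod p) (Fin (p - 1) → ZMod p)) : Subgroup (AutT p) :=
  closure ({rootedA p} ∪ directed '' (V : Set (Fin (p - 1) → ZMod p)))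

variable {V : Submodule (ZMod p) (Fin (p - 1) → ZMod p)}

lemma rootedA_mem : rootedA p ∈ spaceGGS V := subset_closure (Or.inl rfl)

lemma aPow_mem (c : ZMod p) : aPow c ∈ spaceGGS V := pow_mem rootedA_mem _

lemma directed_mem {v : Fin (p - 1) → ZMod p} (hv : v ∈ V) : directed v ∈ spaceGGS V :=
  subset_closure (Or.inr ⟨v, hv, rfl⟩)

lemma conj_mem_spaceGGS : ∀ h ∈ spaceGGS V, ∀ f ∈ spaceGGS V, h * f * h⁻¹ ∈ spaceGGS V :=
  fun _ hh _ hf => mul_mem (mul_mem hh hf) (inv_mem hh)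

lemma multiGGS_eq_spaceGGS [NeZero p] {r : ℕ} (e : Fin r → Fin (p - 1) → ZMod p) :
    multiGGS p e = spaceGGS (Submodule.span (ZMod p) (Set.range e)) := by
  refine le_antisymm (closure_mono (Set.union_subset_union_right _ ?_)) ?_
  · rintro _ ⟨i, rfl⟩
    exact ⟨e i, Submodule.subset_span ⟨i, rfl⟩, rfl⟩
  · rw [spaceGGS, closure_le]
    rintro _ (rfl | ⟨v, hv, rfl⟩)
    · exact subset_closure (Or.inl rfl)
    · have smul_mem : ∀ (k : ℕ) (w : Fin (p - 1) → ZMod p), directed w ∈ multiGGS p e →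
          directed (k • w) ∈ multiGGS p e := fun k w hw => by
        induction k with
        | zero => rw [zero_smul, directed_zero]; exact one_mem _
        | succ k ih => rw [succ_nsmul, directed_add]; exact mul_mem ih hw
      induction hv using Submodule.span_induction with
      | mem v hv =>
        obtain ⟨i, rfl⟩ := hv
        exact subset_closure (Or.inr ⟨i, rfl⟩)
      | zero => rw [directed_zero]; exact one_mem _
      | add v w _ _ hv hw => rw [directed_add]; exact mul_mem hv hw
      | smul c v _ hv =>
        have h := smul_mem c.val v hv
        rwa [← Nat.cast_smul_eq_nsmul (ZMod p), ZMod.natCast_zmod_val] at h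

end Generators

section Exponents

variable {p : ℕ}

/-- `HasExponents V g s w` says that some word in the generators `a` and `b_v`, `v ∈ V`,
evaluates to `g`, has exponent sum `s` in `a`, and contributes `w i` to the vectors of the
directed generators in the section at the vertex with label `i`. -/
inductive HasExponents (V : Submodule (ZMod p) (Fin (p - 1) → ZMod p)) :
    AutT p → ZMod p → (ZMod p → Fin (p - 1) → ZMod p) → Prop
  | one : HasExponents V 1 0 0
  | rootedA_mul {g s w} : HasExponents V g s w → HasExponents V (rootedA p * g) (s + 1) w
  | directed_mul {g s w v} : v ∈ V → HasExponents V g s w →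
      HasExponents V (directed v * g) s (w + Pi.single (-s) v)

variable {V : Submodule (ZMod p) (Fin (p - 1) → ZMod p)}

namespace HasExponents

lemma mem {g s w} (h : HasExponents V g s w) : g ∈ spaceGGS V := by
  induction h with
  | one => exact one_mem _
  | rootedA_mul _ ih => exact mul_mem rootedA_mem ih
  | directed_mul hv _ ih => exact mul_mem (directed_mem hv) ih

lemma label_root {g s w} (h : HasExponents V g s w) (x : Fin p) :
    label (g [] x) = label x + s := by
  induction h with
  | one => simp [one_root]
  | rootedA_mul _ ih =>
    rw [mul_root, Equiv.Perm.mul_apply, rootedA_root, label_finRotate, ih, add_assoc]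
  | directed_mul _ _ ih => rw [mul_root, Equiv.Perm.mul_apply, directed_root,
      Equiv.Perm.one_apply, ih]

lemma rootedA_pow_mul {g s w} (h : HasExponents V g s w) (k : ℕ) :
    HasExponents V (rootedA p ^ k * g) (s + k) w := by
  induction k with
  | zero => simpa using h
  | succ k ih =>
    rw [pow_succ', mul_assoc, Nat.cast_succ, ← add_assoc]
    exact ih.rootedA_mul

lemma exponent_eq_zero [NeZero p] {g s w} (h : HasExponents V g s w) (hg : g [] = 1) :
    s = 0 := by
  have := h.label_root 0
  rwa [hg, Equiv.Perm.one_apply, left_eq_add] at this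

/-- The sections of `g` at the first level have exponents determined by those of `g`. -/
lemma exists_sections [NeZero p] {g s w} (h : HasExponents V g s w) (x : Fin p) :
    ∃ w', HasExponents V (sections g x) (∑ i, hat (w i) (label x - i)) w' ∧
      ∑ i, w' i = w (label x) := by
  induction h with
  | one => exact ⟨0, by simpa [sections_one] using HasExponents.one, by simp⟩
  | rootedA_mul _ ih =>
    rw [sections_mul, sections_rootedA, one_mul]
    exact ih
  | @directed_mul g s w v hv hg ih =>
    obtain ⟨w', h1, h2⟩ := ih
    have hsum : ∑ i, hat ((w + Pi.single (-s) v : ZMod p → Fin (p - 1) → ZMod p) i) (label x - i)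
        = ∑ i, hat (w i) (label x - i) + hat v (label x + s) := by
      simp only [Pi.add_apply, map_add, Finset.sum_add_distrib]
      congr 1
      rw [Finset.sum_eq_single (-s)]
      · simp
      · intro i _ hi
        simp [hi]
      · simp
    rw [hsum, sections_mul, sections_directed, hg.label_root]
    split_ifs with h0
    · rw [h0, hat_zero_right, add_zero]
      refine ⟨_, h1.directed_mul hv, ?_⟩
      have hx : label x = -s := eq_neg_of_add_eq_zero_left h0
      simp [Finset.sum_add_distrib, h2, hx]
    · refine ⟨w', ?_, ?_⟩
      · have := h1.rootedA_pow_mul (hat v (label x + s)).val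
        rwa [ZMod.natCast_zmod_val] at this
      · have hx : label x ≠ -s := fun h => h0 (by rw [h, neg_add_cancel])
        simp [h2, hx]

/-- An element is determined modulo the commutator subgroup by its exponents. -/
lemma exists_commutator [NeZero p] {g s w} (h : HasExponents V g s w) :
    ∃ c ∈ ⁅spaceGGS V, spaceGGS V⁆, g = c * aPow s * directed (∑ i, w i) := by
  have conj_mem := conj_mem_commutator (conj_mem_spaceGGS (V := V)) conj_mem_spaceGGS
  induction h with
  | one => exact ⟨1, one_mem _, by simp [aPow_zero, directed_zero]⟩
  | @rootedA_mul g s w hg ih =>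
    obtain ⟨c, hc, rfl⟩ := ih
    refine ⟨_, conj_mem _ rootedA_mem c hc, ?_⟩
    have : rootedA p = aPow 1 := by simpa using rootedA_pow_eq_aPow (p := p) 1
    rw [add_comm, aPow_add, ← this]
    group
  | @directed_mul g s w v hv hg ih =>
    obtain ⟨c, hc, rfl⟩ := ih
    refine ⟨_, mul_mem (conj_mem _ (directed_mem hv) c hc)
      (commutator_mem_commutator (directed_mem hv) (aPow_mem s)), ?_⟩
    have : ∑ i, (w + Pi.single (-s) v : ZMod p → Fin (p - 1) → ZMod p) i = v + ∑ i, w i := by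
      simp [Finset.sum_add_distrib, add_comm]
    rw [this, directed_add, commutatorElement_def]
    group

end HasExponents

lemma exists_hasExponents [NeZero p] {g : AutT p} (hg : g ∈ spaceGGS V) :
    ∃ s w, HasExponents V g s w := by
  induction hg using closure_induction_left with
  | one => exact ⟨_, _, .one⟩
  | mul_left x hx y _ ih =>
    obtain ⟨s, w, h⟩ := ih
    obtain rfl | ⟨v, hv, rfl⟩ := hx
    · exact ⟨_, _, h.rootedA_mul⟩
    · exact ⟨_, _, h.directed_mul hv⟩
  | inv_mul_cancel x hx y _ ih =>
    obtain ⟨s, w, h⟩ := ih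
    obtain rfl | ⟨v, hv, rfl⟩ := hx
    · have : (rootedA p)⁻¹ = rootedA p ^ (p - 1) := by
        rw [inv_eq_iff_mul_eq_one, ← pow_succ', Nat.sub_add_cancel NeZero.one_le,
          rootedA_pow_self]
      rw [this]
      exact ⟨_, _, h.rootedA_pow_mul _⟩
    · rw [← directed_neg]
      exact ⟨_, _, h.directed_mul (neg_mem hv)⟩

lemma sections_mem [NeZero p] {g : AutT p} (hg : g ∈ spaceGGS V) (x : Fin p) :
    sections g x ∈ spaceGGS V := by
  obtain ⟨s, w, h⟩ := exists_hasExponents hg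
  obtain ⟨w', h', -⟩ := h.exists_sections x
  exact h'.mem

lemma secWord_mem [NeZero p] {g : AutT p} (hg : g ∈ spaceGGS V) (u : List (Fin p)) :
    secWord g u ∈ spaceGGS V := by
  induction u generalizing g with
  | nil => exact hg
  | cons x u ih => exact ih (sections_mem hg x)

/-- Translation by one on functions on `ZMod p`. -/
def shift (p : ℕ) : Module.End (ZMod p) (ZMod p → ZMod p) :=
  LinearMap.funLeft (ZMod p) (ZMod p) (· - 1)

lemma shift_pow_apply (k : ℕ) (f : ZMod p → ZMod p) (y : ZMod p) :
    (shift p ^ k) f y = f (y - k) := by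
  induction k generalizing y with
  | zero => simp
  | succ k ih =>
    rw [pow_succ', Module.End.mul_apply]
    change (shift p ^ k) f (y - 1) = _
    rw [ih]
    push_cast
    congr 1
    ring

lemma shift_sub_one_pow [Fact p.Prime] : (shift p - 1) ^ p = 0 := by
  have : CharP (Module.End (ZMod p) (ZMod p → ZMod p)) p :=
    charP_of_injective_algebraMap (algebraMap (ZMod p) _).injective p
  rw [sub_pow_char_of_commute _ (Commute.one_right _), one_pow, sub_eq_zero]
  refine LinearMap.ext fun f => funext fun y => ?_
  rw [shift_pow_apply]
  simp

lemma shift_pow_sub_mem {j : ℕ} {f : ZMod p → ZMod p}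
    (hf : f ∈ LinearMap.range ((shift p - 1) ^ j)) (k : ℕ) :
    f - (shift p ^ k) f ∈ LinearMap.range ((shift p - 1) ^ (j + 1)) := by
  obtain ⟨g, rfl⟩ := hf
  obtain ⟨c, hc⟩ := sub_one_dvd_pow_sub_one (shift p) k
  refine ⟨-c g, ?_⟩
  have hcomm : Commute (shift p ^ k - 1) ((shift p - 1) ^ j) := by
    refine Commute.pow_right (Commute.sub_left ?_ (Commute.one_left _)) j
    exact Commute.sub_right (Commute.pow_self _ _) (Commute.one_right _)
  have h : (shift p - 1) ^ (j + 1) * c = (shift p ^ k - 1) * (shift p - 1) ^ j := by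
    rw [hcomm.eq, hc, pow_succ, mul_assoc]
  rw [map_neg, ← Module.End.mul_apply, h, Module.End.mul_apply, LinearMap.sub_apply,
    Module.End.one_apply, neg_sub]

lemma hat_sum_mem_range [Fact p.Prime] {j : ℕ} {g s w} (h : HasExponents V g s w)
    (hg : g ∈ levelStab p (j + 1)) :
    hat (∑ i, w i) ∈ LinearMap.range ((shift p - 1) ^ j) := by
  induction j generalizing g s w with
  | zero => simp
  | succ j ih =>
    have hw : ∀ i, hat (w i) ∈ LinearMap.range ((shift p - 1) ^ j) := fun i => by
      obtain ⟨x, rfl⟩ := label_surjective i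
      obtain ⟨w', h', hsum⟩ := h.exists_sections x
      rw [← hsum]
      exact ih h' ((mem_levelStab_succ.mp hg).2 x)
    have hzero : ∑ i : ZMod p, (shift p ^ i.val) (hat (w i)) = 0 := by
      funext y
      obtain ⟨x, rfl⟩ := label_surjective y
      obtain ⟨w', h', -⟩ := h.exists_sections x
      have := h'.exponent_eq_zero
        (root_eq_one_of_mem_levelStab_succ ((mem_levelStab_succ.mp hg).2 x))
      rw [Finset.sum_apply, Pi.zero_apply, ← this]
      exact Finset.sum_congr rfl fun i _ => by rw [shift_pow_apply, ZMod.natCast_zmod_val]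
    have : hat (∑ i, w i) = ∑ i : ZMod p, (hat (w i) - (shift p ^ i.val) (hat (w i))) := by
      rw [Finset.sum_sub_distrib, hzero, sub_zero, map_sum]
    rw [this]
    exact sum_mem fun i _ => shift_pow_sub_mem (hw i) _

lemma mem_commutator_of_mem_levelStab [Fact p.Prime] {g : AutT p} (hg : g ∈ spaceGGS V)
    (hst : g ∈ levelStab p (p + 1)) : g ∈ ⁅spaceGGS V, spaceGGS V⁆ := by
  obtain ⟨s, w, h⟩ := exists_hasExponents hg
  have hs := h.exponent_eq_zero (root_eq_one_of_mem_levelStab_succ hst)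
  have hw := hat_sum_mem_range h hst
  rw [shift_sub_one_pow, LinearMap.range_zero, Submodule.mem_bot] at hw
  rw [← map_zero hat] at hw
  obtain ⟨c, hc, rfl⟩ := h.exists_commutator
  rwa [hs, hat_injective hw, aPow_zero, directed_zero, mul_one, mul_one]

end Exponents

section Branching

variable {p : ℕ} {V : Submodule (ZMod p) (Fin (p - 1) → ZMod p)}

lemma commutator_le_spaceGGS : ⁅spaceGGS V, spaceGGS V⁆ ≤ spaceGGS V :=
  commutator_le.mpr fun _ hg _ hh =>
    mul_mem (mul_mem (mul_mem hg hh) (inv_mem hg)) (inv_mem hh)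

lemma commutator_root {f g : AutT p} : ⁅f, g⁆ [] = ⁅f [], g []⁆ := rfl

lemma sections_commutator {f g : AutT p} (hf : f [] = 1) (hg : g [] = 1) (x : Fin p) :
    sections ⁅f, g⁆ x = ⁅sections f x, sections g x⁆ := by
  simp only [commutatorElement_def, sections_mul, sections_inv, inv_root, hf, hg, inv_one,
    Equiv.Perm.one_apply]

lemma commutator_le_levelStab_one [NeZero p] :
    ⁅spaceGGS V, spaceGGS V⁆ ≤ levelStab p 1 := by
  rw [commutator_le]
  intro g hg h hh
  obtain ⟨s, w, hg⟩ := exists_hasExponents hg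
  obtain ⟨t, u, hh⟩ := exists_hasExponents hh
  rw [mem_levelStab_one, commutator_root, commutatorElement_eq_one_iff_mul_comm]
  refine Equiv.ext fun x => label_injective ?_
  rw [Equiv.Perm.mul_apply, Equiv.Perm.mul_apply, hg.label_root, hh.label_root, hh.label_root,
    hg.label_root, add_right_comm]

/-- The conjugate of `b_v` by a power of `a` whose directed section is at the label `c`. -/
def directedAt (c : ZMod p) (v : Fin (p - 1) → ZMod p) : AutT p :=
  aPow c * directed v * (aPow c)⁻¹

lemma directedAt_root (c : ZMod p) (v : Fin (p - 1) → ZMod p) : directedAt c v [] = 1 := by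
  rw [directedAt, mul_root, mul_root, inv_root, directed_root, mul_one, mul_inv_cancel]

lemma sections_directedAt [NeZero p] (c : ZMod p) (v : Fin (p - 1) → ZMod p) (x : Fin p) :
    sections (directedAt c v) x =
      if label x = c then directed v else aPow (hat v (label x - c)) := by
  rw [directedAt, ← aPow_neg, sections_mul, sections_mul, sections_aPow, sections_aPow, one_mul,
    mul_one, sections_directed, label_aPow, ← sub_eq_add_neg]
  simp only [sub_eq_zero]

lemma directedAt_eq (c : ZMod p) (v : Fin (p - 1) → ZMod p) :
    directedAt c v = ⁅aPow c, directed v⁆ * directed v := by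
  rw [directedAt, commutatorElement_def]
  group

lemma directedAt_mul_inv_mem {v : Fin (p - 1) → ZMod p} (hv : v ∈ V) (c d : ZMod p) :
    directedAt c v * (directedAt d v)⁻¹ ∈ ⁅spaceGGS V, spaceGGS V⁆ := by
  rw [directedAt_eq, directedAt_eq, mul_inv_rev, mul_assoc, mul_inv_cancel_left]
  exact mul_mem (commutator_mem_commutator (aPow_mem c) (directed_mem hv))
    (inv_mem (commutator_mem_commutator (aPow_mem d) (directed_mem hv)))

lemma conj_mem_gamma_three : ∀ h ∈ spaceGGS V, ∀ f ∈ ⁅⁅spaceGGS V, spaceGGS V⁆, spaceGGS V⁆,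
    h * f * h⁻¹ ∈ ⁅⁅spaceGGS V, spaceGGS V⁆, spaceGGS V⁆ :=
  conj_mem_commutator (conj_mem_commutator conj_mem_spaceGGS conj_mem_spaceGGS) conj_mem_spaceGGS

lemma commutator_directedAt_mem [NeZero p] {v w : Fin (p - 1) → ZMod p} (hv : v ∈ V)
    (hw : w ∈ V) (c d : ZMod p) :
    ⁅directedAt c v, directedAt d w⁆ ∈ ⁅⁅spaceGGS V, spaceGGS V⁆, spaceGGS V⁆ := by
  have h1 : ⁅directedAt c v, directedAt d w⁆ =
      aPow c * ⁅directed v, directedAt (d - c) w⁆ * (aPow c)⁻¹ := by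
    rw [directedAt, directedAt, directedAt, sub_eq_add_neg, add_comm, aPow_add, aPow_neg,
      commutatorElement_def, commutatorElement_def]
    group
  rw [h1]
  refine conj_mem_gamma_three _ (aPow_mem c) _ ?_
  rw [directedAt_eq, commutator_mul_right_eq,
    commutatorElement_eq_one_iff_mul_comm.mpr (directed_commute v w).eq, mul_one,
    mul_inv_cancel, mul_one, commutator_comm]
  exact commutator_mem_commutator (directed_mem hv)
    (commutator_mem_commutator (aPow_mem _) (directed_mem hw))

lemma exists_hat_eq_one [Fact p.Prime] {u : Fin (p - 1) → ZMod p} (hu : u ∈ V) {d : ZMod p}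
    (hd : hat u d ≠ 0) (d₀ : ZMod p) (hd₀ : hat u d₀ = 0) :
    ∃ w ∈ V, hat w d = 1 ∧ hat w d₀ = 0 :=
  ⟨(hat u d)⁻¹ • u, V.smul_mem _ hu, by simp [hd], by simp [hd₀]⟩

lemma label_ne (x : Fin p) {d : ZMod p} (hd : d ≠ 0) : label x ≠ label x - d :=
  fun h => hd (sub_eq_self.mp h.symm)

lemma exists_hat_ne_zero {u : Fin (p - 1) → ZMod p} (hu : u ≠ 0) : ∃ d, hat u d ≠ 0 := by
  by_contra! h
  exact hu (hat_injective ((funext h).trans (map_zero hat).symm))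

/-- Every element of the group is a section, at a given level-one vertex, of an element of the
commutator subgroup. -/
lemma exists_mem_commutator_sections_eq [Fact p.Prime]
    (hV : ∀ d, ∃ u ∈ V, u ≠ 0 ∧ hat u d = 0) (x : Fin p) {h : AutT p} (hh : h ∈ spaceGGS V) :
    ∃ H ∈ ⁅spaceGGS V, spaceGGS V⁆, H [] = 1 ∧ sections H x = h := by
  have mul_closed : ∀ f g : AutT p,
      (∃ H ∈ ⁅spaceGGS V, spaceGGS V⁆, H [] = 1 ∧ sections H x = f) →
      (∃ H ∈ ⁅spaceGGS V, spaceGGS V⁆, H [] = 1 ∧ sections H x = g) →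
      ∃ H ∈ ⁅spaceGGS V, spaceGGS V⁆, H [] = 1 ∧ sections H x = f * g := by
    rintro _ _ ⟨F, hF, hF1, rfl⟩ ⟨K, hK, hK1, rfl⟩
    exact ⟨F * K, mul_mem hF hK, by rw [mul_root, hF1, hK1, one_mul],
      by rw [sections_mul, hK1, Equiv.Perm.one_apply]⟩
  have inv_closed : ∀ f : AutT p,
      (∃ H ∈ ⁅spaceGGS V, spaceGGS V⁆, H [] = 1 ∧ sections H x = f) →
      ∃ H ∈ ⁅spaceGGS V, spaceGGS V⁆, H [] = 1 ∧ sections H x = f⁻¹ := by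
    rintro _ ⟨F, hF, hF1, rfl⟩
    exact ⟨F⁻¹, inv_mem hF, by rw [inv_root, hF1, inv_one],
      by rw [sections_inv, hF1, inv_one, Equiv.Perm.one_apply]⟩
  have quot : ∀ v ∈ V, ∀ c d : ZMod p, ∃ H ∈ ⁅spaceGGS V, spaceGGS V⁆, H [] = 1 ∧
      sections H x = sections (directedAt c v) x * (sections (directedAt d v) x)⁻¹ :=
    fun v hv c d => ⟨_, directedAt_mul_inv_mem hv c d,
      by rw [mul_root, inv_root, directedAt_root, directedAt_root, inv_one, one_mul],
      by rw [sections_mul, sections_inv, inv_root, directedAt_root, inv_one,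
        Equiv.Perm.one_apply]⟩
  have hA : ∃ H ∈ ⁅spaceGGS V, spaceGGS V⁆, H [] = 1 ∧ sections H x = rootedA p := by
    obtain ⟨u, hu, hu0, hu1⟩ := hV 1
    obtain ⟨d, hd⟩ := exists_hat_ne_zero hu0
    obtain ⟨w, hw, hwd, hw1⟩ := exists_hat_eq_one hu hd 1 hu1
    have hd0 : d ≠ 0 := by
      rintro rfl
      exact hd (hat_zero_right u)
    obtain ⟨H, hH, hH1, hHx⟩ := quot w hw (label x - d) (label x - 1)
    refine ⟨H, hH, hH1, ?_⟩
    rw [hHx, sections_directedAt, sections_directedAt, if_neg (label_ne x hd0),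
      if_neg (label_ne x one_ne_zero), sub_sub_cancel, sub_sub_cancel, hwd, hw1, aPow_one,
      aPow_zero, inv_one, mul_one]
  induction hh using closure_induction with
  | mem g hg =>
    obtain rfl | ⟨v, hv, rfl⟩ := hg
    · exact hA
    · have hq := quot v hv (label x) (label x - 1)
      rw [sections_directedAt, sections_directedAt, if_pos rfl, if_neg (label_ne x one_ne_zero),
        sub_sub_cancel] at hq
      have hpow : ∀ k : ℕ, ∃ H ∈ ⁅spaceGGS V, spaceGGS V⁆, H [] = 1 ∧
          sections H x = rootedA p ^ k := fun k => by
        induction k with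
        | zero => exact ⟨1, one_mem _, rfl, rfl⟩
        | succ k ih => rw [pow_succ]; exact mul_closed _ _ ih hA
      have := mul_closed _ _ hq (hpow (hat v 1).val)
      rwa [← aPow, inv_mul_cancel_right] at this
  | one => exact ⟨1, one_mem _, rfl, rfl⟩
  | mul f g _ _ hf hg => exact mul_closed f g hf hg
  | inv f _ hf => exact inv_closed f hf

lemma inj_commutator_eq [Fact p.Prime] {v w : Fin (p - 1) → ZMod p} (x : Fin p) (d : ZMod p)
    (hw : hat w d = 1) (hv : hat v (-d) = 0) :
    ⁅directedAt (label x) v, directedAt (label x - d) w⁆ = inj x ⁅directed v, rootedA p⁆ := by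
  have hd : d ≠ 0 := by
    rintro rfl
    rw [hat_zero_right] at hw
    exact zero_ne_one hw
  refine ext_sections ?_ fun y => ?_
  · rw [commutator_root, directedAt_root, commutatorElement_one_left, inj_root]
  rw [sections_commutator (directedAt_root _ _) (directedAt_root _ _), sections_directedAt,
    sections_directedAt, sections_inj]
  by_cases hyx : y = x
  · subst hyx
    rw [if_pos rfl, if_pos rfl, if_neg (label_ne y hd), sub_sub_cancel, hw, aPow_one]
  · rw [if_neg hyx, if_neg (label_injective.ne hyx)]
    split_ifs with hy
    · rw [hy, sub_sub_cancel_left, hv, aPow_zero, commutatorElement_one_left]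
    · exact commutatorElement_eq_one_iff_mul_comm.mpr (aPow_commute _ _).eq

/-- Each vector is a sum of two vectors for which the commutator with `a` is realised at a single
vertex. -/
lemma exists_add_eq [Fact p.Prime] (hV : ∀ d, ∃ u ∈ V, u ≠ 0 ∧ hat u d = 0)
    {v : Fin (p - 1) → ZMod p} (hv : v ∈ V) :
    ∃ v₁ ∈ V, ∃ v₂ ∈ V, v₁ + v₂ = v ∧
      (∃ d, ∃ w ∈ V, hat w d = 1 ∧ hat v₁ (-d) = 0) ∧
      (∃ d, ∃ w ∈ V, hat w d = 1 ∧ hat v₂ (-d) = 0) := by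
  obtain ⟨u₀, hu₀, hu₀0, -⟩ := hV 0
  obtain ⟨d, hd⟩ := exists_hat_ne_zero hu₀0
  obtain ⟨w, hw, hwd, -⟩ := exists_hat_eq_one hu₀ hd 0 (hat_zero_right _)
  obtain ⟨u, hu, hu0, hud⟩ := hV (-d)
  obtain ⟨d', hd'⟩ := exists_hat_ne_zero hu0
  by_cases hall : ∃ u' ∈ V, hat u' (-d') ≠ 0
  · obtain ⟨u', hu', hud'⟩ := hall
    obtain ⟨w', hw', hwd', -⟩ := exists_hat_eq_one hu' hud' 0 (hat_zero_right _)
    have hcu : (hat v d' / hat u d') • u ∈ V := V.smul_mem _ hu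
    refine ⟨v - (hat v d' / hat u d') • u, sub_mem hv hcu, _, hcu, sub_add_cancel _ _,
      ⟨-d', w', hw', hwd', ?_⟩, ⟨d, w, hw, hwd, ?_⟩⟩
    · rw [neg_neg, map_sub, map_smul, Pi.sub_apply, Pi.smul_apply, smul_eq_mul,
        div_mul_cancel₀ _ hd', sub_self]
    · rw [map_smul, Pi.smul_apply, hud, smul_zero]
  · push Not at hall
    obtain ⟨w', hw', hwd', -⟩ := exists_hat_eq_one hu hd' 0 (hat_zero_right _)
    exact ⟨v, hv, 0, V.zero_mem, add_zero v, ⟨d', w', hw', hwd', hall v hv⟩,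
      ⟨d', w', hw', hwd', by simp⟩⟩

lemma inj_mem_gamma_three [Fact p.Prime] (hV : ∀ d, ∃ u ∈ V, u ≠ 0 ∧ hat u d = 0) (x : Fin p)
    {f : AutT p} (hf : f ∈ ⁅spaceGGS V, spaceGGS V⁆) :
    inj x f ∈ ⁅⁅spaceGGS V, spaceGGS V⁆, spaceGGS V⁆ := by
  let N : Subgroup (AutT p) := comap (inj x) ⁅⁅spaceGGS V, spaceGGS V⁆, spaceGGS V⁆
  have hN : ∀ h ∈ spaceGGS V, ∀ f ∈ N, h * f * h⁻¹ ∈ N := by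
    intro h hh f hf
    obtain ⟨H, hH, hH1, rfl⟩ := exists_mem_commutator_sections_eq hV x hh
    have := conj_mem_gamma_three H (commutator_le_spaceGGS hH) _ hf
    rwa [conj_inj, hH1, Equiv.Perm.one_apply] at this
  have hsingle : ∀ v ∈ V, (∃ d, ∃ w ∈ V, hat w d = 1 ∧ hat v (-d) = 0) →
      ⁅directed v, rootedA p⁆ ∈ N := by
    rintro v hv ⟨d, w, hw, hwd, hvd⟩
    rw [mem_comap, ← inj_commutator_eq x d hwd hvd]
    exact commutator_directedAt_mem hv hw _ _
  have hdir : ∀ v ∈ V, ⁅directed v, rootedA p⁆ ∈ N := by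
    intro v hv
    obtain ⟨v₁, hv₁, v₂, hv₂, rfl, h₁, h₂⟩ := exists_add_eq hV hv
    rw [directed_add, commutator_mul_left_eq]
    exact mul_mem (hN _ (directed_mem hv₁) _ (hsingle v₂ hv₂ h₂)) (hsingle v₁ hv₁ h₁)
  suffices ⁅spaceGGS V, spaceGGS V⁆ ≤ N from this hf
  refine commutator_closure_le hN ?_
  rintro _ (rfl | ⟨v, hv, rfl⟩) _ (rfl | ⟨w, hw, rfl⟩)
  · rw [commutatorElement_self]; exact one_mem _
  · rw [← commutatorElement_inv]; exact inv_mem (hdir w hw)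
  · exact hdir v hv
  · rw [commutatorElement_eq_one_iff_mul_comm.mpr (directed_commute v w).eq]; exact one_mem _

lemma gamma_three_le_commutator :
    ⁅⁅spaceGGS V, spaceGGS V⁆, spaceGGS V⁆ ≤ ⁅spaceGGS V, spaceGGS V⁆ :=
  commutator_mono commutator_le_spaceGGS le_rfl

lemma injWord_mem_commutator [Fact p.Prime] (hV : ∀ d, ∃ u ∈ V, u ≠ 0 ∧ hat u d = 0)
    (u : List (Fin p)) {f : AutT p} (hf : f ∈ ⁅spaceGGS V, spaceGGS V⁆) :
    injWord u f ∈ ⁅spaceGGS V, spaceGGS V⁆ := by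
  induction u with
  | nil => exact hf
  | cons x u ih => exact gamma_three_le_commutator (inj_mem_gamma_three hV x ih)

lemma inj_mem_derived [Fact p.Prime] (hV : ∀ d, ∃ u ∈ V, u ≠ 0 ∧ hat u d = 0) (x : Fin p)
    {f : AutT p} (hf : f ∈ ⁅⁅spaceGGS V, spaceGGS V⁆, spaceGGS V⁆) :
    inj x f ∈ ⁅⁅spaceGGS V, spaceGGS V⁆, ⁅spaceGGS V, spaceGGS V⁆⁆ := by
  suffices ⁅⁅spaceGGS V, spaceGGS V⁆, spaceGGS V⁆ ≤
    comap (inj x) ⁅⁅spaceGGS V, spaceGGS V⁆, ⁅spaceGGS V, spaceGGS V⁆⁆ from this hf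
  rw [commutator_le]
  intro g hg h hh
  obtain ⟨H, hH, hH1, rfl⟩ := exists_mem_commutator_sections_eq hV x hh
  rw [mem_comap, ← commutator_inj H g x hH1]
  exact commutator_mem_commutator (injWord_mem_commutator hV [x] hg) hH

/-- The second derived subgroup contains a level stabilizer. -/
lemma mem_derived_of_mem_levelStab [Fact p.Prime] (hV : ∀ d, ∃ u ∈ V, u ≠ 0 ∧ hat u d = 0)
    {g : AutT p} (hg : g ∈ spaceGGS V) (hst : g ∈ levelStab p (p + 3)) :
    g ∈ ⁅⁅spaceGGS V, spaceGGS V⁆, ⁅spaceGGS V, spaceGGS V⁆⁆ := by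
  have gamma : ∀ h ∈ spaceGGS V, h ∈ levelStab p (p + 2) →
      h ∈ ⁅⁅spaceGGS V, spaceGGS V⁆, spaceGGS V⁆ := fun h hh hst => by
    rw [mem_levelStab_succ] at hst
    exact mem_of_inj_sections_mem hst.1 fun x => inj_mem_gamma_three hV x
      (mem_commutator_of_mem_levelStab (sections_mem hh x) (hst.2 x))
  rw [mem_levelStab_succ] at hst
  exact mem_of_inj_sections_mem hst.1 fun x =>
    inj_mem_derived hV x (gamma _ (sections_mem hg x) (hst.2 x))

lemma exists_act_eq [Fact p.Prime] (hV : ∀ d, ∃ u ∈ V, u ≠ 0 ∧ hat u d = 0)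
    {u v : List (Fin p)} (huv : u.length = v.length) : ∃ h ∈ spaceGGS V, act h u = v := by
  induction u generalizing v with
  | nil => exact ⟨1, one_mem _, (List.length_eq_zero_iff.mp huv.symm).symm⟩
  | cons x u ih =>
    cases v with
    | nil => simp at huv
    | cons y v =>
      obtain ⟨h, hh, hu⟩ := ih (v := v) (by simpa using huv)
      obtain ⟨H, hH, hH1, rfl⟩ := exists_mem_commutator_sections_eq hV y hh
      refine ⟨H * aPow (label y - label x), mul_mem (commutator_le_spaceGGS hH) (aPow_mem _), ?_⟩
      have hxy : aPow (label y - label x) [] x = y :=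
        label_injective (by rw [label_aPow, add_sub_cancel])
      rw [act_mul, act_cons (aPow _), hxy, sections_aPow, act_one, act_cons, hH1, hu]
      rfl

lemma infinite_spaceGGS [Fact p.Prime] (hV : ∀ d, ∃ u ∈ V, u ≠ 0 ∧ hat u d = 0) :
    (spaceGGS V : Set (AutT p)).Infinite := by
  intro hfin
  have hfin' := hfin.subset (SetLike.coe_subset_coe.mpr (commutator_le_spaceGGS (V := V)))
  have hsub : (spaceGGS V : Set (AutT p)) ⊆
      (fun H => sections H 0) '' (⁅spaceGGS V, spaceGGS V⁆ : Subgroup (AutT p)) := fun h hh => by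
    obtain ⟨H, hH, -, hHx⟩ := exists_mem_commutator_sections_eq hV 0 hh
    exact ⟨H, hH, hHx⟩
  have heq := Set.eq_of_subset_of_ncard_le
    (SetLike.coe_subset_coe.mpr (commutator_le_spaceGGS (V := V)))
    ((Set.ncard_le_ncard hsub (hfin'.image _)).trans (Set.ncard_image_le hfin')) hfin
  have hmem : rootedA p ∈ ⁅spaceGGS V, spaceGGS V⁆ := by
    rw [← SetLike.mem_coe, heq]
    exact rootedA_mem
  have hroot := mem_levelStab_one.mp (commutator_le_levelStab_one hmem)
  have hlab := label_finRotate (0 : Fin p)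
  rw [← rootedA_root, hroot, Equiv.Perm.one_apply, left_eq_add] at hlab
  exact one_ne_zero hlab

/-- A nontrivial subgroup normalized by the group contains a level stabilizer. -/
lemma exists_levelStab_le [Fact p.Prime] (hV : ∀ d, ∃ u ∈ V, u ≠ 0 ∧ hat u d = 0)
    {N : Subgroup (AutT p)} (hN : ∀ h ∈ spaceGGS V, ∀ f ∈ N, h * f * h⁻¹ ∈ N)
    {g : AutT p} (hg : g ∈ N) (hg1 : g ≠ 1) : ∃ n, spaceGGS V ⊓ levelStab p n ≤ N := by
  obtain ⟨u, hu⟩ := exists_act_ne hg1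
  have commutator_mem_left : ∀ f ∈ N, ∀ h ∈ spaceGGS V, ⁅f, h⁆ ∈ N := fun f hf h hh => by
    rw [commutatorElement_def, mul_assoc, mul_assoc, ← mul_assoc h]
    exact mul_mem hf (hN h hh _ (inv_mem hf))
  have hderived : ⁅⁅spaceGGS V, spaceGGS V⁆, ⁅spaceGGS V, spaceGGS V⁆⁆ ≤ comap (injWord u) N := by
    rw [commutator_le]
    intro k hk l hl
    have hk' := commutator_le_spaceGGS (injWord_mem_commutator hV u (inv_mem hk))
    have hl' := commutator_le_spaceGGS (injWord_mem_commutator hV u hl)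
    have hmem := commutator_mem_left _ (commutator_mem_left g hg _ hk') _ hl'
    have hcomm := injWord_commute (act_length g u) hu
      (secWord g u * k⁻¹ * (secWord g u)⁻¹)
    rw [commutatorElement_def g, conj_injWord, map_inv (injWord u) k, inv_inv,
      commutator_mul_left_eq, commutatorElement_eq_one_iff_mul_comm.mpr (hcomm l).eq, mul_one,
      ← map_commutatorElement, (hcomm ⁅k, l⁆).eq, mul_inv_cancel_right] at hmem
    exact hmem
  refine ⟨u.length + (p + 3), fun f hf => ?_⟩
  obtain ⟨hfG, hfst⟩ := mem_inf.mp hf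
  refine mem_of_injWord_secWord_mem (levelStab_add_le _ _ hfst) fun v hv => ?_
  obtain ⟨h, hh, rfl⟩ := exists_act_eq hV hv.symm
  have hsec := mem_derived_of_mem_levelStab hV (secWord_mem hfG _)
    (secWord_mem_levelStab hv hfst)
  have hconj := conj_mem_commutator
    (conj_mem_commutator conj_mem_spaceGGS conj_mem_spaceGGS)
    (conj_mem_commutator conj_mem_spaceGGS conj_mem_spaceGGS)
    _ (inv_mem (secWord_mem hh u)) _ hsec
  have hmem := hN h hh _ (hderived hconj)
  rw [conj_injWord] at hmem
  convert hmem using 2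
  group

lemma hasCSP_spaceGGS [Fact p.Prime] (hV : ∀ d, ∃ u ∈ V, u ≠ 0 ∧ hat u d = 0) :
    HasCSP (spaceGGS V) := by
  intro H hH
  have : Infinite (spaceGGS V) := (infinite_spaceGGS hV).to_subtype
  have hne : H.normalCore ≠ ⊥ := fun h => by
    have hfin : (⊥ : Subgroup (spaceGGS V)).FiniteIndex := h ▸ inferInstance
    exact hfin.index_ne_zero (by rw [index_bot, Nat.card_eq_zero_of_infinite])
  obtain ⟨g, hg, hg1⟩ := H.normalCore.bot_or_exists_ne_one.resolve_left hne
  have hN : ∀ h ∈ spaceGGS V, ∀ f ∈ H.normalCore.map (spaceGGS V).subtype,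
      h * f * h⁻¹ ∈ H.normalCore.map (spaceGGS V).subtype := by
    rintro h hh _ ⟨f, hf, rfl⟩
    have hconj := mem_map_of_mem (spaceGGS V).subtype
      (H.normalCore_normal.conj_mem f hf ⟨h, hh⟩)
    rwa [map_mul, map_mul, map_inv] at hconj
  obtain ⟨n, hn⟩ := exists_levelStab_le hV hN (mem_map_of_mem _ hg)
    fun h => hg1 (Subtype.ext h)
  refine ⟨n, fun f hf => H.normalCore_le ?_⟩
  obtain ⟨f', hf', hff'⟩ := hn (mem_inf.mpr ⟨f.2, hf⟩)
  rwa [← Subtype.ext hff']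

lemma exists_mem_span_ne_zero_hat_eq_zero [Fact p.Prime] {r : ℕ} (hr : 2 ≤ r)
    {e : Fin r → Fin (p - 1) → ZMod p} (he : LinearIndependent (ZMod p) e) (d : ZMod p) :
    ∃ u ∈ Submodule.span (ZMod p) (Set.range e), u ≠ 0 ∧ hat u d = 0 := by
  let i : Fin r := ⟨0, by lia⟩
  let j : Fin r := ⟨1, by lia⟩
  have hij : i ≠ j := by simp [i, j]
  have hmem : ∀ k, e k ∈ Submodule.span (ZMod p) (Set.range e) := fun k =>
    Submodule.subset_span ⟨k, rfl⟩
  have hinj : Function.Injective ![i, j] := by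
    intro a b
    fin_cases a <;> fin_cases b <;> simp [hij, hij.symm]
  have hpair : LinearIndependent (ZMod p) ![e i, e j] := by
    have := he.comp _ hinj
    rwa [show e ∘ ![i, j] = ![e i, e j] from funext fun a => by fin_cases a <;> rfl] at this
  by_cases h0 : hat (e i) d = 0
  · exact ⟨e i, hmem i, he.ne_zero i, h0⟩
  · refine ⟨(-hat (e j) d) • e i + hat (e i) d • e j,
      add_mem (Submodule.smul_mem _ _ (hmem i)) (Submodule.smul_mem _ _ (hmem j)),
      fun h => h0 (LinearIndependent.pair_iff.mp hpair _ _ h).2, ?_⟩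
    simp only [map_add, map_smul, Pi.add_apply, Pi.smul_apply, smul_eq_mul]
    ring

end Branching

end TreeAut.AutT

/-- A multi-GGS-group with `r ≥ 2` directed generators has the congruence
subgroup property. -/
theorem hasCSP_of_two_le
    (p r : ℕ) (hp : p.Prime) (hpodd : Odd p) (hr : 2 ≤ r)
    (e : Fin r → Fin (p - 1) → ZMod p) (he : LinearIndependent (ZMod p) e) :
    HasCSP (multiGGS p e) := by
  have : Fact p.Prime := ⟨hp⟩
  rw [multiGGS_eq_spaceGGS]
  exact hasCSP_spaceGGS (exists_mem_span_ne_zero_hat_eq_zero hr he)
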